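/- The first moment of the self-similar profile satisfies ∫₀^∞ z g(z) dz = −4 g''(0) = Γ(3/4)/π. -/

import Mathlib

open MeasureTheory Real Filter Set

/-- Fourth-order heat kernel `G_t(x) = (1/π)∫₀^∞ e^{−t k⁴} cos(kx) dk`. -/
noncomputable def G (t x : ℝ) : ℝ :=
  (1 / Real.pi) * ∫ k in Set.Ioi (0:ℝ), Real.exp (-t * k ^ 4) * Real.cos (k * x)

/-- First spatial derivative `G_t'(x) = −(1/π)∫₀^∞ k e^{−t k⁴} sin(kx) dk`. -/
noncomputable def G₁ (t x : ℝ) : ℝ :=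
  -(1 / Real.pi) * ∫ k in Set.Ioi (0:ℝ), k * Real.exp (-t * k ^ 4) * Real.sin (k * x)

/-- Second spatial derivative `G_t''(x) = −(1/π)∫₀^∞ k² e^{−t k⁴} cos(kx) dk`. -/
noncomputable def G₂ (t x : ℝ) : ℝ :=
  -(1 / Real.pi) * ∫ k in Set.Ioi (0:ℝ), k ^ 2 * Real.exp (-t * k ^ 4) * Real.cos (k * x)

/-- Self-similar profile `g(z) = (1/π)∫₀^∞ e^{−k⁴} cos(kz) dk`. -/
noncomputable def gprof (z : ℝ) : ℝ :=
  (1 / Real.pi) * ∫ k in Set.Ioi (0:ℝ), Real.exp (-k ^ 4) * Real.cos (k * z)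

/-- Cosine transform of `k ^ n * exp (-k ^ 4)` on the half-line. -/
noncomputable def cosMoment (n : ℕ) (z : ℝ) : ℝ :=
  ∫ k in Ioi (0:ℝ), k ^ n * exp (-k ^ 4) * cos (k * z)

/-- Sine transform of `k ^ n * exp (-k ^ 4)` on the half-line. -/
noncomputable def sinMoment (n : ℕ) (z : ℝ) : ℝ :=
  ∫ k in Ioi (0:ℝ), k ^ n * exp (-k ^ 4) * sin (k * z)

lemma integrableOn_pow_mul_exp_neg_pow_four (n : ℕ) :
    IntegrableOn (fun k : ℝ => k ^ n * exp (-k ^ 4)) (Ioi 0) := by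
  have h := integrableOn_rpow_mul_exp_neg_rpow (p := 4) (s := n)
    (by have := n.cast_nonneg (α := ℝ); linarith) (by norm_num)
  refine h.congr_fun (fun k _ => ?_) measurableSet_Ioi
  norm_cast

lemma integral_sq_mul_exp_neg_pow_four :
    ∫ k in Ioi (0:ℝ), k ^ 2 * exp (-k ^ 4) = Gamma (3 / 4) / 4 := by
  have h := integral_rpow_mul_exp_neg_rpow (p := 4) (q := 2) (by norm_num) (by norm_num)
  have e : ∫ k in Ioi (0:ℝ), k ^ 2 * exp (-k ^ 4) =
      ∫ k in Ioi (0:ℝ), k ^ (2:ℝ) * exp (-k ^ (4:ℝ)) := by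
    refine setIntegral_congr_fun measurableSet_Ioi (fun k _ => ?_)
    norm_cast
  rw [e, h, show ((2:ℝ) + 1) / 4 = 3 / 4 by norm_num]
  ring

lemma integrableOn_mul_of_abs_le_one (n : ℕ) {u : ℝ → ℝ} (hu : Continuous u)
    (hb : ∀ k, |u k| ≤ 1) :
    IntegrableOn (fun k : ℝ => k ^ n * exp (-k ^ 4) * u k) (Ioi 0) :=
  (integrableOn_pow_mul_exp_neg_pow_four n).mul_bdd (c := 1) hu.aestronglyMeasurable
    (Eventually.of_forall hb)

lemma integrableOn_cos (n : ℕ) (z : ℝ) :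
    IntegrableOn (fun k : ℝ => k ^ n * exp (-k ^ 4) * cos (k * z)) (Ioi 0) :=
  integrableOn_mul_of_abs_le_one n (by fun_prop) fun _ => abs_cos_le_one _

lemma integrableOn_sin (n : ℕ) (z : ℝ) :
    IntegrableOn (fun k : ℝ => k ^ n * exp (-k ^ 4) * sin (k * z)) (Ioi 0) :=
  integrableOn_mul_of_abs_le_one n (by fun_prop) fun _ => abs_sin_le_one _

lemma abs_integral_mul_le (n : ℕ) {u : ℝ → ℝ} (hb : ∀ k, |u k| ≤ 1) :
    |∫ k in Ioi (0:ℝ), k ^ n * exp (-k ^ 4) * u k| ≤ cosMoment n 0 := by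
  simp only [cosMoment, mul_zero, cos_zero, mul_one]
  rw [← norm_eq_abs]
  refine norm_integral_le_of_norm_le (integrableOn_pow_mul_exp_neg_pow_four n) ?_
  filter_upwards [ae_restrict_mem measurableSet_Ioi] with k hk
  have hk : 0 < k := hk
  rw [norm_mul, norm_of_nonneg (by positivity)]
  exact mul_le_of_le_one_right (by positivity) (hb k)

lemma abs_cosMoment_le (n : ℕ) (z : ℝ) : |cosMoment n z| ≤ cosMoment n 0 :=
  abs_integral_mul_le n fun _ => abs_cos_le_one _

lemma abs_sinMoment_le (n : ℕ) (z : ℝ) : |sinMoment n z| ≤ cosMoment n 0 :=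
  abs_integral_mul_le n fun _ => abs_sin_le_one _

lemma hasDerivAt_cosMoment (n : ℕ) (z : ℝ) :
    HasDerivAt (cosMoment n) (-sinMoment (n + 1) z) z := by
  have h := hasDerivAt_integral_of_dominated_loc_of_deriv_le
    (μ := volume.restrict (Ioi (0:ℝ))) (x₀ := z) (s := univ)
    (F := fun z k => k ^ n * exp (-k ^ 4) * cos (k * z))
    (F' := fun z k => -(k ^ (n + 1) * exp (-k ^ 4) * sin (k * z)))
    (bound := fun k => k ^ (n + 1) * exp (-k ^ 4)) univ_mem
    (Eventually.of_forall fun x => (integrableOn_cos n x).aestronglyMeasurable)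
    (integrableOn_cos n z) (integrableOn_sin (n + 1) z).neg.aestronglyMeasurable ?_
    (integrableOn_pow_mul_exp_neg_pow_four (n + 1)) ?_
  · exact h.2.congr_deriv (integral_neg _)
  · filter_upwards [ae_restrict_mem measurableSet_Ioi] with k hk x _
    have hk : 0 < k := hk
    rw [norm_neg, norm_mul, norm_of_nonneg (by positivity)]
    exact mul_le_of_le_one_right (by positivity) (abs_sin_le_one _)
  · refine Eventually.of_forall fun k x _ => ?_
    have := (((hasDerivAt_id x).const_mul k).cos).const_mul (k ^ n * exp (-k ^ 4))
    refine this.congr_deriv ?_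
    simp only [id]
    ring

lemma hasDerivAt_sinMoment (n : ℕ) (z : ℝ) :
    HasDerivAt (sinMoment n) (cosMoment (n + 1) z) z := by
  refine (hasDerivAt_integral_of_dominated_loc_of_deriv_le
    (μ := volume.restrict (Ioi (0:ℝ))) (x₀ := z) (s := univ)
    (F := fun z k => k ^ n * exp (-k ^ 4) * sin (k * z))
    (F' := fun z k => k ^ (n + 1) * exp (-k ^ 4) * cos (k * z))
    (bound := fun k => k ^ (n + 1) * exp (-k ^ 4)) univ_mem
    (Eventually.of_forall fun x => (integrableOn_sin n x).aestronglyMeasurable)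
    (integrableOn_sin n z) (integrableOn_cos (n + 1) z).aestronglyMeasurable ?_
    (integrableOn_pow_mul_exp_neg_pow_four (n + 1)) ?_).2
  · filter_upwards [ae_restrict_mem measurableSet_Ioi] with k hk x _
    have hk : 0 < k := hk
    rw [norm_mul, norm_of_nonneg (by positivity)]
    exact mul_le_of_le_one_right (by positivity) (abs_cos_le_one _)
  · refine Eventually.of_forall fun k x _ => ?_
    have := (((hasDerivAt_id x).const_mul k).sin).const_mul (k ^ n * exp (-k ^ 4))
    refine this.congr_deriv ?_
    simp only [id]
    ring

lemma hasDerivAt_pow_mul_exp_neg_pow_four (n : ℕ) (k : ℝ) :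
    HasDerivAt (fun k : ℝ => k ^ n * exp (-k ^ 4))
      (n * (k ^ (n - 1) * exp (-k ^ 4)) - 4 * (k ^ (n + 3) * exp (-k ^ 4))) k := by
  refine ((hasDerivAt_pow n k).mul (hasDerivAt_pow 4 k).neg.exp).congr_deriv ?_
  simp only [Pi.neg_apply]
  push_cast
  ring

lemma integral_Ioi_deriv_eq_neg {f f' : ℝ → ℝ} (hd : ∀ k, HasDerivAt f (f' k) k)
    (hf : IntegrableOn f (Ioi 0)) (hf' : IntegrableOn f' (Ioi 0)) :
    ∫ k in Ioi (0:ℝ), f' k = -f 0 := by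
  rw [integral_Ioi_of_hasDerivAt_of_tendsto' (fun k _ => hd k) hf'
    (tendsto_zero_of_hasDerivAt_of_integrableOn_Ioi (fun k _ => hd k) hf' hf), zero_sub]

lemma mul_cosMoment (n : ℕ) (z : ℝ) :
    z * cosMoment n z = 4 * sinMoment (n + 3) z - n * sinMoment (n - 1) z := by
  have hs := fun m => integrableOn_sin m z
  have hc := integrableOn_cos n z
  have hi : IntegrableOn (fun k => n * (k ^ (n - 1) * exp (-k ^ 4) * sin (k * z))
      - 4 * (k ^ (n + 3) * exp (-k ^ 4) * sin (k * z))) (Ioi 0) :=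
    ((hs (n - 1)).const_mul (n:ℝ)).sub ((hs (n + 3)).const_mul 4)
  have key := integral_Ioi_deriv_eq_neg
    (f' := fun k => (n * (k ^ (n - 1) * exp (-k ^ 4) * sin (k * z))
      - 4 * (k ^ (n + 3) * exp (-k ^ 4) * sin (k * z)))
      + z * (k ^ n * exp (-k ^ 4) * cos (k * z)))
    (fun k => ((hasDerivAt_pow_mul_exp_neg_pow_four n k).mul
      (((hasDerivAt_id k).mul_const z).sin)).congr_deriv (by simp only [id]; ring))
    (hs n) (hi.add (hc.const_mul z))
  rw [integral_add hi (hc.const_mul z),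
    integral_sub ((hs (n - 1)).const_mul (n:ℝ)) ((hs (n + 3)).const_mul 4)] at key
  simp only [integral_const_mul] at key
  simp only [Pi.mul_apply, id, zero_mul, sin_zero, mul_zero, neg_zero] at key
  unfold cosMoment sinMoment
  linarith

lemma mul_sinMoment (n : ℕ) (z : ℝ) :
    z * sinMoment (n + 1) z = (n + 1) * cosMoment n z - 4 * cosMoment (n + 4) z := by
  have hc := fun m => integrableOn_cos m z
  have hs := integrableOn_sin (n + 1) z
  have hi : IntegrableOn (fun k => (n + 1 : ℝ) * (k ^ n * exp (-k ^ 4) * cos (k * z))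
      - 4 * (k ^ (n + 4) * exp (-k ^ 4) * cos (k * z))) (Ioi 0) :=
    ((hc n).const_mul (n + 1 : ℝ)).sub ((hc (n + 4)).const_mul 4)
  have key := integral_Ioi_deriv_eq_neg
    (f' := fun k => ((n + 1 : ℝ) * (k ^ n * exp (-k ^ 4) * cos (k * z))
      - 4 * (k ^ (n + 4) * exp (-k ^ 4) * cos (k * z)))
      - z * (k ^ (n + 1) * exp (-k ^ 4) * sin (k * z)))
    (fun k => ((hasDerivAt_pow_mul_exp_neg_pow_four (n + 1) k).mul
      (((hasDerivAt_id k).mul_const z).cos)).congr_deriv (by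
        simp only [id, Nat.add_sub_cancel]; push_cast; ring))
    (hc (n + 1)) (hi.sub (hs.const_mul z))
  rw [integral_sub hi (hs.const_mul z),
    integral_sub ((hc n).const_mul (n + 1 : ℝ)) ((hc (n + 4)).const_mul 4)] at key
  simp only [integral_const_mul] at key
  simp only [Pi.mul_apply, id, ne_eq, Nat.add_eq_zero_iff, one_ne_zero, and_false,
    not_false_eq_true, zero_pow, zero_mul, neg_zero] at key
  unfold cosMoment sinMoment
  linarith

lemma tendsto_cosMoment_atTop (n : ℕ) : Tendsto (cosMoment n) atTop (nhds 0) := by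
  refine squeeze_zero_norm' (a := fun z =>
    (4 * cosMoment (n + 3) 0 + n * cosMoment (n - 1) 0) / z) ?_
    (tendsto_const_nhds.div_atTop tendsto_id)
  filter_upwards [eventually_gt_atTop 0] with z hz
  rw [le_div_iff₀ hz, norm_eq_abs, ← abs_of_pos hz, ← abs_mul, mul_comm, abs_of_pos hz,
    mul_cosMoment]
  refine (abs_sub _ _).trans ?_
  rw [abs_mul, abs_mul, Nat.abs_cast, abs_of_pos (by norm_num : (0:ℝ) < 4)]
  gcongr <;> exact abs_sinMoment_le _ _

lemma integrable_sinMoment_three : Integrable (sinMoment 3) := by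
  have hcont : Continuous (sinMoment 3) :=
    continuous_iff_continuousAt.2 fun z => (hasDerivAt_sinMoment 3 z).continuousAt
  refine (integrable_inv_one_add_sq.const_mul (cosMoment 3 0 + 6 * cosMoment 1 0
    + 36 * cosMoment 5 0 + 16 * cosMoment 9 0)).mono' hcont.aestronglyMeasurable
    (Eventually.of_forall fun z => ?_)
  have h : z ^ 2 * sinMoment 3 z
      = -6 * sinMoment 1 z + 36 * sinMoment 5 z - 16 * sinMoment 9 z := by
    have h1 := mul_sinMoment 2 z
    have h2 := mul_cosMoment 2 z
    have h3 := mul_cosMoment 6 z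
    norm_num at h1 h2 h3
    linear_combination z * h1 + 3 * h2 - 4 * h3
  rw [← div_eq_mul_inv, le_div_iff₀ (by positivity), norm_eq_abs,
    ← abs_of_pos (show 0 < 1 + z ^ 2 by positivity), ← abs_mul]
  rw [show sinMoment 3 z * (1 + z ^ 2) = sinMoment 3 z + z ^ 2 * sinMoment 3 z by ring, h]
  have h1 := abs_le.1 (abs_sinMoment_le 1 z)
  have h3 := abs_le.1 (abs_sinMoment_le 3 z)
  have h5 := abs_le.1 (abs_sinMoment_le 5 z)
  have h9 := abs_le.1 (abs_sinMoment_le 9 z)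
  exact abs_le.2 ⟨by linarith, by linarith⟩

lemma cosMoment_two_zero : cosMoment 2 0 = Gamma (3 / 4) / 4 := by
  simpa [cosMoment] using integral_sq_mul_exp_neg_pow_four

lemma integral_sinMoment_three : ∫ z in Ioi (0:ℝ), sinMoment 3 z = cosMoment 2 0 := by
  have h := integral_Ioi_of_hasDerivAt_of_tendsto' (a := 0)
    (fun z _ => hasDerivAt_cosMoment 2 z)
    integrable_sinMoment_three.neg.integrableOn (tendsto_cosMoment_atTop 2)
  rw [integral_neg] at h
  linarith

lemma gprof_eq : gprof = fun z => 1 / π * cosMoment 0 z := by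
  funext z
  simp [gprof, cosMoment]

lemma iteratedDeriv_two_gprof_zero :
    iteratedDeriv 2 gprof 0 = -(Gamma (3 / 4) / (4 * π)) := by
  have h1 : deriv gprof = fun z => 1 / π * -sinMoment 1 z := by
    funext z
    rw [gprof_eq]
    exact ((hasDerivAt_cosMoment 0 z).const_mul _).deriv
  have h2 : HasDerivAt (fun z => 1 / π * -sinMoment 1 z) (1 / π * -cosMoment 2 0) 0 :=
    (hasDerivAt_sinMoment 1 0).neg.const_mul (1 / π)
  rw [iteratedDeriv_succ, iteratedDeriv_one, h1, h2.deriv, cosMoment_two_zero]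
  field_simp

lemma integral_mul_gprof : ∫ z in Ioi (0:ℝ), z * gprof z = Gamma (3 / 4) / π := by
  have h : ∀ z, z * gprof z = 4 / π * sinMoment 3 z := fun z => by
    have := mul_cosMoment 0 z
    norm_num at this
    rw [gprof_eq]
    linear_combination 1 / π * this
  simp only [h]
  rw [integral_const_mul, integral_sinMoment_three, cosMoment_two_zero]
  field_simp

/-- `∫₀^∞ z g(z) dz = −4 g''(0) = Γ(3/4)/π`. -/
theorem stmt12 :
    (∫ z in Set.Ioi (0:ℝ), z * gprof z) = -4 * iteratedDeriv 2 gprof 0 ∧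
    (∫ z in Set.Ioi (0:ℝ), z * gprof z) = Real.Gamma (3/4) / Real.pi := by
  refine ⟨?_, integral_mul_gprof⟩
  rw [integral_mul_gprof, iteratedDeriv_two_gprof_zero]
  field_simp
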